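/- Let ELMO(E_i)_{i=1}^n be the ELMO protocol, the constrained composition of the ELMO components E_1, …, E_n under the composition constraint φ_ELMO(⟨i, receive⟩, σ, m) = (Σ_{j ∈ global_equivocators_full(σ')} weight(j) < t), where σ' is the composite state resulting from the transition (φ_ELMO imposes no condition on send labels). Then every component E_i is a validator for ELMO(E_i)_{i=1}^n: every constrained transition from a constrained state of E_i lifts to a valid transition of ELMO(E_i)_{i=1}^n with the same label on component i, the same input and output messages, and matching i-th state components. -/

import Mathlib

set_option autoImplicit false

universe u v w

/-- A validating labelled state transition and message production system (VLSM):
labels, a nonempty set of initial states, initial messages, a total transition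
function and a validity constraint.  `Option M` plays the role of `M ∪ {⊥}`. -/
structure VLSM (L : Type u) (S : Type v) (M : Type w) where
  init : Set S
  init_ne : init.Nonempty
  initMsg : Set M
  tau : L → S → Option M → S × Option M
  beta : L → S → Option M → Prop

/-- A transition record: label, source state, input message, target state, output message. -/
structure VTrans (L : Type u) (S : Type v) (M : Type w) where
  lbl : L
  src : S
  msg : Option M
  dst : S
  out : Option M

variable {L : Type u} {S : Type v} {M : Type w}

/-- `Chain s tr sf`: the transitions of `tr` link up, starting at `s` and ending at `sf`. -/
def Chain : S → List (VTrans L S M) → S → Prop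
  | s, [], sf => s = sf
  | s, t :: ts, sf => t.src = s ∧ Chain t.dst ts sf

namespace VLSM

/-- `t` is an actual transition of `V` (the transition function agrees with `t`). -/
def IsTrans (V : VLSM L S M) (t : VTrans L S M) : Prop :=
  V.tau t.lbl t.src t.msg = (t.dst, t.out)

/-- `t` is a constrained transition of `V`. -/
def IsConstrainedTrans (V : VLSM L S M) (t : VTrans L S M) : Prop :=
  V.IsTrans t ∧ V.beta t.lbl t.src t.msg

/-- `tr` is a constrained trace of `V` reaching the state `sf`. -/
def ConstrainedTraceTo (V : VLSM L S M) (tr : List (VTrans L S M)) (sf : S) : Prop :=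
  (∀ t ∈ tr, V.IsConstrainedTrans t) ∧ ∃ s0 ∈ V.init, Chain s0 tr sf

/-- A state is constrained if some constrained trace reaches it. -/
def ConstrainedState (V : VLSM L S M) (s : S) : Prop :=
  ∃ tr, V.ConstrainedTraceTo tr s

/-- Constrained reachability, defined inductively (a state is constrained iff it is
reachable from an initial state by constrained transitions). -/
inductive ReachState (V : VLSM L S M) : S → Prop where
  | init {s} : s ∈ V.init → ReachState V s
  | step {l s m} : ReachState V s → V.beta l s m → ReachState V (V.tau l s m).1

mutual
  /-- Valid states of a VLSM. -/
  inductive ValidState (V : VLSM L S M) : S → Prop where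
    | init {s} : s ∈ V.init → ValidState V s
    | step {l s m} : ValidState V s → ValidOMsg V m → V.beta l s m →
        ValidState V (V.tau l s m).1
  /-- Valid optional messages of a VLSM (`none` is always valid). -/
  inductive ValidOMsg (V : VLSM L S M) : Option M → Prop where
    | none : ValidOMsg V Option.none
    | init {m} : m ∈ V.initMsg → ValidOMsg V (some m)
    | step {l s m} : ValidState V s → ValidOMsg V m → V.beta l s m →
        ValidOMsg V (V.tau l s m).2
end

/-- `t` is a valid transition of `V`. -/
def IsValidTrans (V : VLSM L S M) (t : VTrans L S M) : Prop :=
  V.IsConstrainedTrans t ∧ V.ValidState t.src ∧ V.ValidOMsg t.msg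

/-- `tr` is a valid trace of `V` reaching the state `sf`. -/
def ValidTraceTo (V : VLSM L S M) (tr : List (VTrans L S M)) (sf : S) : Prop :=
  (∀ t ∈ tr, V.IsValidTrans t) ∧ ∃ s0 ∈ V.init, Chain s0 tr sf

/-- `tr` is a valid trace of `V`. -/
def IsValidTrace (V : VLSM L S M) (tr : List (VTrans L S M)) : Prop :=
  ∃ sf, V.ValidTraceTo tr sf

end VLSM

/-- The message `m` is emitted (sent) on the trace `tr`. -/
def EmittedOn (tr : List (VTrans L S M)) (m : M) : Prop := ∃ t ∈ tr, t.out = some m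

/-- The message `m` is received on the trace `tr`. -/
def ReceivedOn (tr : List (VTrans L S M)) (m : M) : Prop := ∃ t ∈ tr, t.msg = some m

/-- `sent` is a sent-oracle for `V`: at every constrained state `s`, `sent s m` holds
iff `m` is emitted on every constrained trace reaching `s`. -/
def IsSentOracle (V : VLSM L S M) (sent : S → M → Prop) : Prop :=
  ∀ s, V.ConstrainedState s → ∀ m,
    (sent s m ↔ ∀ tr, V.ConstrainedTraceTo tr s → EmittedOn tr m)

/-- `recv` is a received-oracle for `V`. -/
def IsReceivedOracle (V : VLSM L S M) (recv : S → M → Prop) : Prop :=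
  ∀ s, V.ConstrainedState s → ∀ m,
    (recv s m ↔ ∀ tr, V.ConstrainedTraceTo tr s → ReceivedOn tr m)

/-- The full node assumption: whenever receiving `m` is allowed by the validity
constraint, every direct dependency of `m` has been directly observed in the state. -/
def FullNodeAssumption (V : VLSM L S M) (dep : M → M → Prop)
    (sent recv : S → M → Prop) : Prop :=
  ∀ l s m, V.beta l s (some m) → ∀ m', dep m' m → sent s m' ∨ recv s m'

section Composition

variable {ι : Type*} [DecidableEq ι] {Lf : ι → Type*} {Sf : ι → Type*}

/-- The constrained composition of an indexed family of VLSMs over the same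
message set, under the composition constraint `φ`. -/
noncomputable def comp (V : ∀ i, VLSM (Lf i) (Sf i) M)
    (φ : (Σ i, Lf i) → (∀ i, Sf i) → Option M → Prop) :
    VLSM (Σ i, Lf i) (∀ i, Sf i) M where
  init := {σ | ∀ i, σ i ∈ (V i).init}
  init_ne := ⟨fun i => ((V i).init_ne).choose, fun i => ((V i).init_ne).choose_spec⟩
  initMsg := ⋃ i, (V i).initMsg
  tau := fun l σ m =>
    (Function.update σ l.1 ((V l.1).tau l.2 (σ l.1) m).1, ((V l.1).tau l.2 (σ l.1) m).2)
  beta := fun l σ m => (V l.1).beta l.2 (σ l.1) m ∧ φ l σ m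

/-- The free composition of an indexed family of VLSMs over the same message set. -/
noncomputable def freeComp (V : ∀ i, VLSM (Lf i) (Sf i) M) :
    VLSM (Σ i, Lf i) (∀ i, Sf i) M :=
  comp V fun _ _ _ => True

/-- Component `j` is a validator for the composite VLSM `W`: every constrained
transition from a constrained state of `V j` lifts to a valid transition of `W`
with matching `j`-th state components and matching input/output messages. -/
def IsValidatorAt (V : ∀ i, VLSM (Lf i) (Sf i) M)
    (W : VLSM (Σ i, Lf i) (∀ i, Sf i) M) (j : ι) : Prop :=
  ∀ l s m, (V j).ConstrainedState s → (V j).beta l s m →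
    ∃ σ : ∀ i, Sf i, σ j = s ∧
      W.IsValidTrans ⟨⟨j, l⟩, σ, m, (W.tau ⟨j, l⟩ σ m).1, (W.tau ⟨j, l⟩ σ m).2⟩ ∧
      (W.tau ⟨j, l⟩ σ m).1 j = ((V j).tau l s m).1 ∧
      (W.tau ⟨j, l⟩ σ m).2 = ((V j).tau l s m).2

/-- The induced `j`-th projection of a composite VLSM `W`: the same VLSM as the
component `Vj`, except that its initial messages are all valid messages of `W`. -/
def projV {L' : Type*} {S' : Type*} {L2 : Type*} {S2 : Type*}
    (Vj : VLSM L' S' M) (W : VLSM L2 S2 M) : VLSM L' S' M :=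
  { Vj with initMsg := {m | W.ValidOMsg (some m)} }

/-- The projection of a composite trace on component `j`. -/
def projTrace (j : ι) (tr : List (VTrans (Σ i, Lf i) (∀ i, Sf i) M)) :
    List (VTrans (Lf j) (Sf j) M) :=
  tr.filterMap fun t =>
    if h : t.lbl.1 = j then some ⟨h ▸ t.lbl.2, t.src j, t.msg, t.dst j, t.out⟩ else none

/-- The composition constraint of the fixed-set message-equivocation model:
the only message-equivocations allowed are among the components of `E`. -/
def phiM (sender : M → ι) (sent : ∀ i, Sf i → M → Prop) (E : Set ι) :
    (Σ i, Lf i) → (∀ i, Sf i) → Option M → Prop :=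
  fun l σ m => ∀ mm, m = some mm →
    (sent (sender mm) (σ (sender mm)) mm ∨ (l.1 ∈ E ∧ sender mm ∈ E))

end Composition

/-- Labels of the equivocating VLSM associated to a VLSM: act as the `i`-th copy,
duplicate the `i`-th copy, or spawn a new machine after position `i` (1-based). -/
inductive ELabel (L : Type u) (S : Type v) where
  | act (i : ℕ) (l : L)
  | dup (i : ℕ)
  | new (i : ℕ) (s : S)

/-- The equivocating VLSM associated to a VLSM `V`: its states are (nonempty) lists
of states of `V`, and it can fork itself or spawn fresh copies at any moment. -/
noncomputable def eVLSM (V : VLSM L S M) : VLSM (ELabel L S) (List S) M where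
  init := {γ | ∃ s ∈ V.init, γ = [s]}
  init_ne := ⟨[V.init_ne.choose], V.init_ne.choose, V.init_ne.choose_spec, rfl⟩
  initMsg := V.initMsg
  tau := fun lab γ m =>
    match lab with
    | .act i l =>
      match γ[i - 1]? with
      | some s => (γ.set (i - 1) (V.tau l s m).1, (V.tau l s m).2)
      | none => (γ, Option.none)
    | .dup i =>
      match γ[i - 1]? with
      | some s => (γ.take i ++ s :: γ.drop i, Option.none)
      | none => (γ, Option.none)
    | .new i s0 => (γ.take i ++ s0 :: γ.drop i, Option.none)
  beta := fun lab γ m =>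
    match lab with
    | .act i l => 1 ≤ i ∧ i ≤ γ.length ∧ ∃ s, γ[i - 1]? = some s ∧ V.beta l s m
    | .dup i => 1 ≤ i ∧ i ≤ γ.length ∧ m = Option.none
    | .new i s0 => 1 ≤ i ∧ i ≤ γ.length ∧ m = Option.none ∧ s0 ∈ V.init

/-- The two labels of UMO/MO/ELMO components. -/
inductive UL where
  | send
  | recv
deriving DecidableEq

/-- States (= messages) of UMO components: a finite list of message observations
together with an address. -/
inductive UState where
  | mk (obs : List (UL × UState)) (addr : ℕ)

/-- The list of message observations of a state. -/
def UState.obs : UState → List (UL × UState)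
  | .mk o _ => o

/-- The address of a state. -/
def UState.addr : UState → ℕ
  | .mk _ i => i

/-- The set of messages observed as sent in a state. -/
def UState.sentMessages (s : UState) : Set UState := {m | (UL.send, m) ∈ s.obs}

/-- The set of messages observed as received in a state. -/
def UState.receivedMessages (s : UState) : Set UState := {m | (UL.recv, m) ∈ s.obs}

/-- The set of messages observed in a state. -/
def UState.messages (s : UState) : Set UState := {m | ∃ l, (l, m) ∈ s.obs}

/-- The validity constraint of UMO components. -/
def betaUMO (l : UL) (_ : UState) (m : Option UState) : Prop :=
  (l = UL.send ∧ m = Option.none) ∨ (l = UL.recv ∧ m ≠ Option.none)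

/-- The transition function of UMO (and MO, ELMO) components. -/
def tauUMO (l : UL) (s : UState) (m : Option UState) : UState × Option UState :=
  match l, m with
  | .send, Option.none => (UState.mk (s.obs ++ [(UL.send, s)]) s.addr, some s)
  | .recv, some mm => (UState.mk (s.obs ++ [(UL.recv, mm)]) s.addr, Option.none)
  | _, _ => (s, m)

/-- The UMO component of address `i`. -/
noncomputable def UMO (i : ℕ) : VLSM UL UState UState where
  init := {UState.mk [] i}
  init_ne := ⟨UState.mk [] i, rfl⟩
  initMsg := ∅
  tau := tauUMO
  beta := betaUMO

/-- The UMO protocol: the free composition of the UMO components of addresses 1,…,n. -/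
noncomputable def UMOProtocol (n : ℕ) : VLSM (Σ _ : Fin n, UL) (Fin n → UState) UState :=
  freeComp fun k : Fin n => UMO (k.1 + 1)

/-- The indirect message dependency relation on UMO states/messages: the least
transitive relation with `m₁ < m₂` whenever `m₁ ∈ messages(m₂)`. -/
def mlt : UState → UState → Prop :=
  Relation.TransGen fun a b => a ∈ b.messages

/-- Two messages are incomparable: same sender (address), distinct, and neither is
(indirectly) observed in the other. -/
def Incomp (m m' : UState) : Prop :=
  m.addr = m'.addr ∧ m ≠ m' ∧ ¬ mlt m m' ∧ ¬ mlt m' m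

open scoped Classical in
/-- Helper for `localEquivocatorsFull`, recursing over the reversed observation list. -/
noncomputable def lefAux : List (UL × UState) → Finset ℕ
  | [] => ∅
  | (l, m) :: rest =>
      if l = UL.recv ∧ ∃ m', (UL.recv, m') ∈ rest ∧ Incomp m m' then
        insert m.addr (lefAux rest)
      else lefAux rest

/-- The set of locally evidenced equivocators in a state (full-node version):
`local_equivocators_full`. -/
noncomputable def localEquivocatorsFull (s : UState) : Finset ℕ :=
  lefAux s.obs.reverse

/-- The local equivocators of a state: addresses `j` for which there exist two
incomparable messages of address `j`, both observed in the state. -/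
def localEquivUMO (s : UState) : Set ℕ :=
  {j | ∃ m m', m.addr = j ∧ m'.addr = j ∧ Incomp m m' ∧ mlt m s ∧ mlt m' s}

/-- The full node condition: all dependencies of the message have been observed. -/
def FullNodeU (s m : UState) : Prop := m.messages ⊆ s.messages

/-- No self-equivocation: a message with the component's own address must have
been sent by the component. -/
def NoSelfEquiv (s m : UState) : Prop :=
  m.addr = s.addr → (UL.send, m) ∈ s.obs

/-- The message-validity predicate `ψ_msg_valid_full` of ELMO components, as an
inductive predicate capturing its recursive definition on the last observation. -/
inductive MsgValidFull (n : ℕ) : UState → Prop where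
  | nil {j} : 1 ≤ j → j ≤ n → MsgValidFull n (.mk [] j)
  | snocSend {o j} : MsgValidFull n (.mk o j) →
      MsgValidFull n (.mk (o ++ [(UL.send, .mk o j)]) j)
  | snocRecv {o j mp} : MsgValidFull n (.mk o j) →
      FullNodeU (.mk o j) mp → NoSelfEquiv (.mk o j) mp →
      MsgValidFull n (.mk (o ++ [(UL.recv, mp)]) j)

/-- The receive-validity predicate `ψ_ELMO` of ELMO components. -/
noncomputable def psiELMO (n : ℕ) (w : ℕ → ℝ) (t : ℝ) (s m : UState) : Prop :=
  FullNodeU s m ∧ MsgValidFull n m ∧ NoSelfEquiv s m ∧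
    (∑ j ∈ localEquivocatorsFull (UState.mk (s.obs ++ [(UL.recv, m)]) s.addr), w j) < t

/-- The ELMO component of address `i`, with threshold `t` and weight function `w`. -/
noncomputable def ELMO (n : ℕ) (w : ℕ → ℝ) (t : ℝ) (i : ℕ) : VLSM UL UState UState :=
  { UMO i with
    beta := fun l s m =>
      betaUMO l s m ∧ (l = UL.recv → ∀ mm, m = some mm → psiELMO n w t s mm) }

open scoped Classical in
/-- The messages observed in some component of a composite state, as a finite set. -/
noncomputable def compObsMsgs {n : ℕ} (σ : Fin n → UState) : Finset UState :=
  Finset.univ.biUnion fun k => ((σ k).obs.map Prod.snd).toFinset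

open scoped Classical in
/-- `global_equivocators_full`: addresses of messages observed in some component of
the composite state but observed as sent in no component. -/
noncomputable def globalEquivocatorsFull {n : ℕ} (σ : Fin n → UState) : Finset ℕ :=
  ((compObsMsgs σ).filter fun m => ∀ k, (UL.send, m) ∉ (σ k).obs).image UState.addr

/-- The composition constraint `φ_ELMO` of the ELMO protocol: upon a receive
transition, the total weight of globally evidenced (full-node) equivocators in the
resulting composite state stays below the threshold. -/
noncomputable def phiELMO (n : ℕ) (w : ℕ → ℝ) (t : ℝ) :
    (Σ _ : Fin n, UL) → (Fin n → UState) → Option UState → Prop :=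
  fun l σ m => l.2 = UL.recv →
    (∑ j ∈ globalEquivocatorsFull
        (Function.update σ l.1 ((ELMO n w t (l.1.1 + 1)).tau l.2 (σ l.1) m).1), w j) < t

/-- The ELMO protocol: the constrained composition of the ELMO components of
addresses 1,…,n under `φ_ELMO`. -/
noncomputable def ELMOProtocol (n : ℕ) (w : ℕ → ℝ) (t : ℝ) :
    VLSM (Σ _ : Fin n, UL) (Fin n → UState) UState :=
  comp (fun k : Fin n => ELMO n w t (k.1 + 1)) (phiELMO n w t)

/-- Reachability of ELMO states, irrespective of the address of the component. -/
inductive ELMOReach (n : ℕ) (w : ℕ → ℝ) (t : ℝ) : UState → Prop where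
  | nil {j} : 1 ≤ j → j ≤ n → ELMOReach n w t (.mk [] j)
  | send {o j} : ELMOReach n w t (.mk o j) →
      ELMOReach n w t (.mk (o ++ [(UL.send, .mk o j)]) j)
  | recv {o j m} : ELMOReach n w t (.mk o j) → psiELMO n w t (.mk o j) m →
      ELMOReach n w t (.mk (o ++ [(UL.recv, m)]) j)

/-! ### Structure of valid messages -/

lemma Incomp.symm {a b : UState} (h : Incomp a b) : Incomp b a :=
  ⟨h.1.symm, h.2.1.symm, h.2.2.2, h.2.2.1⟩

lemma mem_lefAux {j : ℕ} {l : List (UL × UState)} :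
    j ∈ lefAux l ↔ ∃ a b, (UL.recv, a) ∈ l ∧ (UL.recv, b) ∈ l ∧ Incomp a b ∧ a.addr = j := by
  induction l with
  | nil => simp [lefAux]
  | cons x rest ih =>
    obtain ⟨l, m⟩ := x
    have key : j ∈ lefAux ((l, m) :: rest) ↔
        ((l = UL.recv ∧ ∃ m', (UL.recv, m') ∈ rest ∧ Incomp m m') ∧ j = m.addr) ∨
          j ∈ lefAux rest := by
      rw [lefAux]
      split_ifs with h
      · simp [h]
      · simp [h]
    rw [key, ih]
    constructor
    · rintro (⟨⟨rfl, m', hm', hi⟩, rfl⟩ | ⟨a, b, ha, hb, hi, rfl⟩)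
      · exact ⟨m, m', by simp, by simp [hm'], hi, rfl⟩
      · exact ⟨a, b, by simp [ha], by simp [hb], hi, rfl⟩
    · rintro ⟨a, b, ha, hb, hi, rfl⟩
      simp only [List.mem_cons, Prod.mk.injEq] at ha hb
      rcases ha with ⟨rfl, rfl⟩ | ha <;> rcases hb with ⟨hb, rfl⟩ | hb
      · exact absurd rfl hi.2.1
      · exact Or.inl ⟨⟨rfl, b, hb, hi⟩, rfl⟩
      · exact Or.inl ⟨⟨hb.symm, a, ha, hi.symm⟩, hi.1⟩
      · exact Or.inr ⟨a, b, ha, hb, hi, rfl⟩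

lemma mem_localEquivocatorsFull {j : ℕ} {s : UState} :
    j ∈ localEquivocatorsFull s ↔
      ∃ a b, (UL.recv, a) ∈ s.obs ∧ (UL.recv, b) ∈ s.obs ∧ Incomp a b ∧ a.addr = j := by
  simp [localEquivocatorsFull, mem_lefAux]

lemma localEquivocatorsFull_mono {s s' : UState} (h : s.obs ⊆ s'.obs) :
    localEquivocatorsFull s ⊆ localEquivocatorsFull s' := by
  intro j hj
  obtain ⟨a, b, ha, hb, hi⟩ := mem_localEquivocatorsFull.1 hj
  exact mem_localEquivocatorsFull.2 ⟨a, b, h ha, h hb, hi⟩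

lemma UState.mk_obs_addr (s : UState) : UState.mk s.obs s.addr = s := by
  cases s
  rfl

lemma messages_mono {s s' : UState} (h : s.obs ⊆ s'.obs) : s.messages ⊆ s'.messages :=
  fun _ ⟨l, hl⟩ => ⟨l, h hl⟩

lemma messages_mk_append {o : List (UL × UState)} {j : ℕ} {l : UL} {m x : UState} :
    x ∈ (UState.mk (o ++ [(l, m)]) j).messages ↔ x ∈ (UState.mk o j).messages ∨ x = m := by
  simp [UState.messages, UState.obs, exists_or]

lemma messages_mk_subset_append (o : List (UL × UState)) (j : ℕ) (x : UL × UState) :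
    (UState.mk o j).messages ⊆ (UState.mk (o ++ [x]) j).messages :=
  fun _ h => messages_mk_append.2 (Or.inl h)

namespace MsgValidFull

variable {n : ℕ} {s : UState}

lemma addr_mem (h : MsgValidFull n s) : 1 ≤ s.addr ∧ s.addr ≤ n := by
  induction h with
  | nil h1 h2 => exact ⟨h1, h2⟩
  | snocSend _ ih => exact ih
  | snocRecv _ _ _ ih => exact ih

lemma messages_subset (h : MsgValidFull n s) {x : UState} (hx : x ∈ s.messages) :
    x.messages ⊆ s.messages := by
  induction h with
  | nil => simp [UState.messages, UState.obs] at hx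
  | snocSend _ ih =>
    refine Set.Subset.trans ?_ (messages_mk_subset_append _ _ _)
    rcases messages_mk_append.1 hx with hx | rfl
    · exact ih hx
    · exact subset_rfl
  | snocRecv _ hf _ ih =>
    refine Set.Subset.trans ?_ (messages_mk_subset_append _ _ _)
    rcases messages_mk_append.1 hx with hx | rfl
    · exact ih hx
    · exact hf

lemma mem_messages_of_mlt (h : MsgValidFull n s) {x : UState} (hx : mlt x s) :
    x ∈ s.messages := by
  induction hx using Relation.TransGen.head_induction_on with
  | single hx => exact hx
  | head hab _ ih => exact h.messages_subset ih hab

lemma addr_of_send (h : MsgValidFull n s) {x : UState} (hx : (UL.send, x) ∈ s.obs) :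
    x.addr = s.addr := by
  induction h with
  | nil => simp [UState.obs] at hx
  | snocSend _ ih =>
    simp only [UState.obs, List.mem_append, List.mem_singleton, Prod.mk.injEq] at hx
    rcases hx with hx | ⟨-, rfl⟩
    · exact ih hx
    · rfl
  | snocRecv _ _ _ ih =>
    simp only [UState.obs, List.mem_append, List.mem_singleton, Prod.mk.injEq, reduceCtorEq,
      false_and, or_false] at hx
    exact ih hx

lemma send_of_addr (h : MsgValidFull n s) {x : UState} (hx : x ∈ s.messages)
    (ha : x.addr = s.addr) : (UL.send, x) ∈ s.obs := by
  induction h with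
  | nil => simp [UState.messages, UState.obs] at hx
  | snocSend _ ih =>
    rcases messages_mk_append.1 hx with hx | rfl
    · exact List.mem_append_left _ (ih hx ha)
    · simp [UState.obs]
  | snocRecv _ _ hn ih =>
    rcases messages_mk_append.1 hx with hx | rfl
    · exact List.mem_append_left _ (ih hx ha)
    · exact List.mem_append_left _ (hn ha)

lemma prefix_of_send (h : MsgValidFull n s) {x : UState} (hx : (UL.send, x) ∈ s.obs) :
    x.obs ++ [(UL.send, x)] <+: s.obs := by
  induction h with
  | nil => simp [UState.obs] at hx
  | snocSend _ ih =>
    simp only [UState.obs, List.mem_append, List.mem_singleton, Prod.mk.injEq] at hx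
    rcases hx with hx | ⟨-, rfl⟩
    · exact (ih hx).trans (List.prefix_append _ _)
    · exact List.prefix_rfl
  | snocRecv _ _ _ ih =>
    simp only [UState.obs, List.mem_append, List.mem_singleton, Prod.mk.injEq, reduceCtorEq,
      false_and, or_false] at hx
    exact (ih hx).trans (List.prefix_append _ _)

lemma not_incomp_of_send (h : MsgValidFull n s) {a b : UState} (ha : (UL.send, a) ∈ s.obs)
    (hb : (UL.send, b) ∈ s.obs) : ¬ Incomp a b := by
  have key : ∀ {c d : UState}, c.obs ++ [(UL.send, c)] <+: d.obs → ¬ Incomp c d :=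
    fun hcd hi => hi.2.2.1 (.single ⟨UL.send, hcd.subset (by simp)⟩)
  have hpa := h.prefix_of_send ha
  have hpb := h.prefix_of_send hb
  intro hi
  rcases List.prefix_or_prefix_of_prefix hpa hpb with hp | hp
  · rcases List.prefix_concat_iff.1 hp with he | hp
    · have := List.append_inj_right' he rfl
      simp only [List.cons.injEq, Prod.mk.injEq, true_and, and_true] at this
      exact hi.2.1 this
    · exact key hp hi
  · rcases List.prefix_concat_iff.1 hp with he | hp
    · have := List.append_inj_right' he rfl
      simp only [List.cons.injEq, Prod.mk.injEq, true_and, and_true] at this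
      exact hi.2.1 this.symm
    · exact key hp hi.symm

/-- Equivocation evidence drawn from the messages of a valid state is local evidence. -/
lemma localEquivocatorsFull_subset (h : MsgValidFull n s) {p : UState}
    (hp : p.messages ⊆ s.messages) :
    localEquivocatorsFull p ⊆ localEquivocatorsFull s := by
  intro j hj
  obtain ⟨a, b, ha, hb, hi, hj⟩ := mem_localEquivocatorsFull.1 hj
  have ha' := hp ⟨_, ha⟩
  have hb' := hp ⟨_, hb⟩
  have hne : a.addr ≠ s.addr := fun he =>
    h.not_incomp_of_send (h.send_of_addr ha' he) (h.send_of_addr hb' (hi.1 ▸ he)) hi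
  have recv_of : ∀ x ∈ s.messages, x.addr ≠ s.addr → (UL.recv, x) ∈ s.obs := by
    rintro x ⟨l, hl⟩ hx
    cases l
    · exact absurd (h.addr_of_send hl) hx
    · exact hl
  exact mem_localEquivocatorsFull.2
    ⟨a, b, recv_of a ha' hne, recv_of b hb' (hi.1 ▸ hne), hi, hj⟩

end MsgValidFull

namespace ELMOReach

variable {n : ℕ} {w : ℕ → ℝ} {t : ℝ} {s : UState}

lemma msgValidFull (h : ELMOReach n w t s) : MsgValidFull n s := by
  induction h with
  | nil h1 h2 => exact .nil h1 h2
  | send _ ih => exact .snocSend ih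
  | recv _ hp ih => exact .snocRecv ih hp.1 hp.2.2.1

lemma msgValidFull_of_mem (h : ELMOReach n w t s) {x : UState} (hx : x ∈ s.messages) :
    MsgValidFull n x := by
  induction h with
  | nil => simp [UState.messages, UState.obs] at hx
  | send h ih =>
    rcases messages_mk_append.1 hx with hx | rfl
    · exact ih hx
    · exact h.msgValidFull
  | recv _ hp ih =>
    rcases messages_mk_append.1 hx with hx | rfl
    · exact ih hx
    · exact hp.2.1

lemma addr_mem_of_mem_localEquivocatorsFull (h : ELMOReach n w t s) {j : ℕ}
    (hj : j ∈ localEquivocatorsFull s) : 1 ≤ j ∧ j ≤ n := by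
  obtain ⟨a, b, ha, -, -, rfl⟩ := mem_localEquivocatorsFull.1 hj
  exact (h.msgValidFull_of_mem ⟨_, ha⟩).addr_mem

lemma sum_lt_of_subset (hw : ∀ j, 1 ≤ j → j ≤ n → 0 < w j) (h : ELMOReach n w t s)
    (hs : ∑ j ∈ localEquivocatorsFull s, w j < t) {A : Finset ℕ}
    (hA : A ⊆ localEquivocatorsFull s) : ∑ j ∈ A, w j < t := by
  refine (Finset.sum_le_sum_of_subset_of_nonneg hA fun j hj _ => ?_).trans_lt hs
  obtain ⟨h1, h2⟩ := h.addr_mem_of_mem_localEquivocatorsFull hj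
  exact (hw j h1 h2).le

lemma sum_localEquivocatorsFull_lt (ht : 0 < t) (h : ELMOReach n w t s) :
    ∑ j ∈ localEquivocatorsFull s, w j < t := by
  induction h with
  | nil => simpa [localEquivocatorsFull, lefAux, UState.obs] using ht
  | @send o j _ ih =>
    have : localEquivocatorsFull (.mk (o ++ [(UL.send, .mk o j)]) j) =
        localEquivocatorsFull (.mk o j) := by
      ext i
      simp [mem_localEquivocatorsFull, UState.obs]
    rwa [this]
  | recv _ hp _ => exact hp.2.2.2

/-- A valid message all of whose dependencies are observed in a reachable state is itself a
reachable state. -/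
lemma of_messages_subset (hw : ∀ j, 1 ≤ j → j ≤ n → 0 < w j) (ht : 0 < t)
    (h : ELMOReach n w t s) {m : UState} (hm : MsgValidFull n m)
    (hms : m.messages ⊆ s.messages) : ELMOReach n w t m := by
  induction hm with
  | nil h1 h2 => exact .nil h1 h2
  | snocSend _ ih =>
    exact .send (ih ((messages_mk_subset_append _ _ _).trans hms))
  | snocRecv _ hf hn ih =>
    refine .recv (ih ((messages_mk_subset_append _ _ _).trans hms))
      ⟨hf, h.msgValidFull_of_mem (hms (messages_mk_append.2 (Or.inr rfl))), hn, ?_⟩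
    exact h.sum_lt_of_subset hw (h.sum_localEquivocatorsFull_lt ht)
      (h.msgValidFull.localEquivocatorsFull_subset hms)

lemma of_mem (hw : ∀ j, 1 ≤ j → j ≤ n → 0 < w j) (ht : 0 < t)
    (h : ELMOReach n w t s) {x : UState} (hx : x ∈ s.messages) : ELMOReach n w t x :=
  h.of_messages_subset hw ht (h.msgValidFull_of_mem hx) (h.msgValidFull.messages_subset hx)

end ELMOReach

lemma ELMO_step_reach {n : ℕ} {w : ℕ → ℝ} {t : ℝ} {i : ℕ} {l : UL} {s : UState}
    {m : Option UState} (hs : ELMOReach n w t s) (hb : (ELMO n w t i).beta l s m) :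
    ELMOReach n w t ((ELMO n w t i).tau l s m).1 ∧
      ((ELMO n w t i).tau l s m).1.addr = s.addr := by
  obtain ⟨o, j⟩ := s
  obtain ⟨⟨rfl, rfl⟩ | ⟨rfl, hm⟩, hp⟩ := hb
  · exact ⟨.send hs, rfl⟩
  · obtain ⟨m, rfl⟩ := Option.ne_none_iff_exists'.1 hm
    exact ⟨.recv hs (hp rfl m rfl), rfl⟩

lemma ELMO_constrainedState_reach {n : ℕ} {w : ℕ → ℝ} {t : ℝ} {i : ℕ} (h1 : 1 ≤ i) (h2 : i ≤ n)
    {s : UState} (hs : (ELMO n w t i).ConstrainedState s) :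
    ELMOReach n w t s ∧ s.addr = i := by
  obtain ⟨tr, htr, s0, hs0, hc⟩ := hs
  have h0 : ELMOReach n w t s0 ∧ s0.addr = i := by
    obtain rfl : s0 = .mk [] i := hs0
    exact ⟨.nil h1 h2, rfl⟩
  clear hs0
  induction tr generalizing s0 with
  | nil => exact (show s0 = s from hc) ▸ h0
  | cons tn ts ih =>
    obtain ⟨hsrc, hc⟩ := hc
    obtain ⟨htn, hbeta⟩ := htr tn List.mem_cons_self
    have hstep := ELMO_step_reach (hsrc ▸ h0.1) hbeta
    rw [show (ELMO n w t i).tau tn.lbl tn.src tn.msg = (tn.dst, tn.out) from htn, hsrc] at hstep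
    exact ih (fun t' ht' => htr t' (List.mem_cons_of_mem _ ht')) tn.dst hc
      ⟨hstep.1, hstep.2.trans h0.2⟩

/-! ### Global equivocators -/

lemma mem_globalEquivocatorsFull {n : ℕ} {σ : Fin n → UState} {a : ℕ} :
    a ∈ globalEquivocatorsFull σ ↔
      ∃ x : UState, (∃ i, x ∈ (σ i).messages) ∧ (∀ i, (UL.send, x) ∉ (σ i).obs) ∧
        x.addr = a := by
  simp [globalEquivocatorsFull, compObsMsgs, UState.messages, and_assoc]

lemma globalEquivocatorsFull_update_subset {n : ℕ} {σ : Fin n → UState} {j : Fin n}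
    {p : UState} {B : Finset ℕ} (hB : globalEquivocatorsFull σ ⊆ B)
    (hsub : (σ j).obs ⊆ p.obs)
    (hrecv : ∀ x, (UL.recv, x) ∈ p.obs →
      (∃ i, x ∈ (σ i).messages) ∨ (∃ i, (UL.send, x) ∈ (σ i).obs) ∨ x.addr ∈ B) :
    globalEquivocatorsFull (Function.update σ j p) ⊆ B := by
  intro a ha
  obtain ⟨x, ⟨i, hi⟩, hns, rfl⟩ := mem_globalEquivocatorsFull.1 ha
  have hns' : ∀ i, (UL.send, x) ∉ (σ i).obs := by
    intro i hx
    apply hns i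
    by_cases hij : i = j
    · subst hij
      simpa using hsub hx
    · simpa [Function.update_of_ne hij] using hx
  have hobs : (∃ i, x ∈ (σ i).messages) → x.addr ∈ B := fun h =>
    hB (mem_globalEquivocatorsFull.2 ⟨x, h, hns', rfl⟩)
  by_cases hij : i = j
  · subst hij
    rw [Function.update_self] at hi
    obtain ⟨l, hl⟩ := hi
    cases l
    · exact absurd (by simpa using hl) (hns i)
    · rcases hrecv x hl with h | ⟨i', h⟩ | h
      · exact hobs h
      · exact absurd h (hns' i')
      · exact h
  · rw [Function.update_of_ne hij] at hi
    exact hobs ⟨i, hi⟩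

/-! ### Lifting to the protocol -/

section Lifting

variable {n : ℕ} {w : ℕ → ℝ} {t : ℝ}

lemma ELMOProtocol_valid_send {σ : Fin n → UState} (hσ : (ELMOProtocol n w t).ValidState σ)
    (j : Fin n) {o : List (UL × UState)} {i : ℕ} (hj : σ j = .mk o i) :
    (ELMOProtocol n w t).ValidState
        (Function.update σ j (.mk (o ++ [(UL.send, .mk o i)]) i)) ∧
      (ELMOProtocol n w t).ValidOMsg (some (.mk o i)) := by
  have hb : (ELMOProtocol n w t).beta ⟨j, UL.send⟩ σ none :=
    ⟨⟨Or.inl ⟨rfl, rfl⟩, fun h => by cases h⟩, fun h => by cases h⟩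
  have h1 := VLSM.ValidState.step hσ .none hb
  have h2 := VLSM.ValidOMsg.step hσ .none hb
  have htau : (ELMOProtocol n w t).tau ⟨j, UL.send⟩ σ none =
      (Function.update σ j (.mk ((σ j).obs ++ [(UL.send, σ j)]) (σ j).addr), some (σ j)) := rfl
  rw [htau, hj] at h1 h2
  exact ⟨h1, h2⟩

lemma ELMOProtocol_beta_recv {σ : Fin n → UState} (j : Fin n) {o : List (UL × UState)} {i : ℕ}
    (hj : σ j = .mk o i) {m : UState} (hψ : psiELMO n w t (.mk o i) m)
    (hφ : ∑ a ∈ globalEquivocatorsFull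
      (Function.update σ j (.mk (o ++ [(UL.recv, m)]) i)), w a < t) :
    (ELMOProtocol n w t).beta ⟨j, UL.recv⟩ σ (some m) := by
  refine ⟨⟨Or.inr ⟨rfl, by simp⟩, ?_⟩, fun _ => ?_⟩
  · rintro - _ ⟨⟩
    exact hj.symm ▸ hψ
  · have htau : (ELMO n w t (j.1 + 1)).tau UL.recv (σ j) (some m) =
        (.mk ((σ j).obs ++ [(UL.recv, m)]) (σ j).addr, none) := rfl
    change ∑ a ∈ globalEquivocatorsFull (Function.update σ j
      ((ELMO n w t (j.1 + 1)).tau UL.recv (σ j) (some m)).1), w a < t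
    rw [htau, hj]
    exact hφ

lemma ELMOProtocol_valid_recv {σ : Fin n → UState} (hσ : (ELMOProtocol n w t).ValidState σ)
    (j : Fin n) {o : List (UL × UState)} {i : ℕ} (hj : σ j = .mk o i) {m : UState}
    (hm : (ELMOProtocol n w t).ValidOMsg (some m)) (hψ : psiELMO n w t (.mk o i) m)
    (hφ : ∑ a ∈ globalEquivocatorsFull
      (Function.update σ j (.mk (o ++ [(UL.recv, m)]) i)), w a < t) :
    (ELMOProtocol n w t).ValidState
        (Function.update σ j (.mk (o ++ [(UL.recv, m)]) i)) := by
  have h1 := VLSM.ValidState.step hσ hm (ELMOProtocol_beta_recv j hj hψ hφ)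
  have htau : (ELMOProtocol n w t).tau ⟨j, UL.recv⟩ σ (some m) =
      (Function.update σ j (.mk ((σ j).obs ++ [(UL.recv, m)]) (σ j).addr), none) := rfl
  rw [htau, hj] at h1
  exact h1

/-- If every message of `p` has already been observed by component `k`, then another component
`j` can advance to `p` without creating new global equivocators. -/
lemma ELMOProtocol_valid_advance {σ : Fin n → UState}
    (hσ : (ELMOProtocol n w t).ValidState σ) {j k : Fin n}
    {B : Finset ℕ} (hB : globalEquivocatorsFull σ ⊆ B)
    (hsum : ∀ A ⊆ B, ∑ a ∈ A, w a < t)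
    (hmsg : ∀ x ∈ (σ k).messages, (ELMOProtocol n w t).ValidOMsg (some x))
    {p : UState} (hp : ELMOReach n w t p) (haddr : p.addr = (σ j).addr)
    (hpk : p.messages ⊆ (σ k).messages) (hpre : (σ j).obs <+: p.obs) :
    (ELMOProtocol n w t).ValidState (Function.update σ j p) ∧
      globalEquivocatorsFull (Function.update σ j p) ⊆ B := by
  refine ⟨?_, globalEquivocatorsFull_update_subset hB hpre.subset
    fun x hx => Or.inl ⟨k, hpk ⟨_, hx⟩⟩⟩
  have heq : ∀ {p : UState}, p.addr = (σ j).addr → (σ j).obs = p.obs → p = σ j := by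
    rintro ⟨o, i⟩ h1 h2
    rcases hj : σ j with ⟨o', i'⟩
    rw [hj] at h1 h2
    cases h1
    cases h2
    rfl
  induction hp with
  | nil =>
    rw [heq haddr (List.prefix_nil.1 hpre), Function.update_eq_self]
    exact hσ
  | send _ ih =>
    rcases List.prefix_concat_iff.1 hpre with he | hpre
    · rw [heq haddr he, Function.update_eq_self]
      exact hσ
    · have h := ih haddr ((messages_mk_subset_append _ _ _).trans hpk) hpre
      simpa using (ELMOProtocol_valid_send h j (Function.update_self ..)).1
  | @recv o i m _ hψ ih =>
    rcases List.prefix_concat_iff.1 hpre with he | hpre'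
    · rw [heq haddr he, Function.update_eq_self]
      exact hσ
    · have h := ih haddr ((messages_mk_subset_append _ _ _).trans hpk) hpre'
      have := ELMOProtocol_valid_recv h j (Function.update_self ..)
        (hmsg m (hpk (messages_mk_append.2 (Or.inr rfl)))) hψ
      rw [Function.update_idem] at this
      exact this (hsum _ (globalEquivocatorsFull_update_subset hB hpre.subset
        fun x hx => Or.inl ⟨k, hpk ⟨_, hx⟩⟩))

/-- `σ` is a valid composite state whose `k`-th component is `s`, whose global equivocators are
locally evidenced in `s`, and in which every other component that is not a local equivocator of
`s` has just sent a message received in `s` (or is still in its initial state). -/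
structure ELMOLift (n : ℕ) (w : ℕ → ℝ) (t : ℝ) (k : Fin n) (s : UState)
    (σ : Fin n → UState) : Prop where
  valid : (ELMOProtocol n w t).ValidState σ
  eq : σ k = s
  global_subset : globalEquivocatorsFull σ ⊆ localEquivocatorsFull s
  latest : ∀ j, j ≠ k → j.1 + 1 ∉ localEquivocatorsFull s →
    σ j = .mk [] (j.1 + 1) ∨ ∃ m, (UL.recv, m) ∈ s.obs ∧ m.addr = j.1 + 1 ∧
      σ j = .mk (m.obs ++ [(UL.send, m)]) (j.1 + 1)

lemma ELMOLift.init (k : Fin n) :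
    ELMOLift n w t k (.mk [] (k.1 + 1)) fun j => .mk [] (j.1 + 1) where
  valid := .init fun _ => rfl
  eq := rfl
  global_subset := by
    intro a ha
    obtain ⟨x, ⟨i, l, hl⟩, -⟩ := mem_globalEquivocatorsFull.1 ha
    simp [UState.obs] at hl
  latest := fun _ _ _ => Or.inl rfl

lemma ELMOLift.send {k : Fin n} {o : List (UL × UState)} {i : ℕ} {σ : Fin n → UState}
    (h : ELMOLift n w t k (.mk o i) σ) :
    ELMOLift n w t k (.mk (o ++ [(UL.send, .mk o i)]) i)
      (Function.update σ k (.mk (o ++ [(UL.send, .mk o i)]) i)) where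
  valid := (ELMOProtocol_valid_send h.valid k h.eq).1
  eq := Function.update_self ..
  global_subset := by
    refine globalEquivocatorsFull_update_subset
      (h.global_subset.trans (localEquivocatorsFull_mono (List.subset_append_left _ _)))
      (by rw [h.eq]; exact List.subset_append_left _ _) fun x hx => Or.inl ⟨k, ?_⟩
    rw [h.eq]
    exact ⟨UL.recv, by simpa [UState.obs] using hx⟩
  latest := by
    intro j hj hl
    rw [Function.update_of_ne hj]
    rcases h.latest j hj fun h' => hl
      (localEquivocatorsFull_mono (List.subset_append_left _ _) h') with h | ⟨m, hm, h⟩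
    · exact Or.inl h
    · exact Or.inr ⟨m, List.mem_append_left _ hm, h⟩

/-- Before a lift of `s` receives a message, its other components can be advanced so that
the reception only creates global equivocators that are locally evidenced. -/
lemma ELMOLift.exists_recv (hw : ∀ j, 1 ≤ j → j ≤ n → 0 < w j) (ht : 0 < t)
    {k : Fin n} {o : List (UL × UState)} {i : ℕ} {σ : Fin n → UState} {m : UState}
    (h : ELMOLift n w t k (.mk o i) σ) (hi : i = k.1 + 1) (hs : ELMOReach n w t (.mk o i))
    (hψ : psiELMO n w t (.mk o i) m) (hm : (ELMOProtocol n w t).ValidOMsg (some m))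
    (hmsg : ∀ x ∈ (UState.mk o i).messages, (ELMOProtocol n w t).ValidOMsg (some x)) :
    ∃ σ', (ELMOProtocol n w t).ValidState σ' ∧ σ' k = .mk o i ∧
      (ELMOProtocol n w t).beta ⟨k, UL.recv⟩ σ' (some m) ∧
      ELMOLift n w t k (.mk (o ++ [(UL.recv, m)]) i)
        (Function.update σ' k (.mk (o ++ [(UL.recv, m)]) i)) := by
  set s' : UState := .mk (o ++ [(UL.recv, m)]) i with hs'
  have hsub : (UState.mk o i).obs ⊆ s'.obs := List.subset_append_left _ _
  have hlef : localEquivocatorsFull (.mk o i) ⊆ localEquivocatorsFull s' :=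
    localEquivocatorsFull_mono hsub
  have hsum : ∀ A ⊆ localEquivocatorsFull s', ∑ a ∈ A, w a < t := fun A hA =>
    (ELMOReach.recv hs hψ).sum_lt_of_subset hw hψ.2.2.2 hA
  have hG := h.global_subset.trans hlef
  have hlatest : ∀ j, j ≠ k → j.1 + 1 ∉ localEquivocatorsFull s' →
      σ j = .mk [] (j.1 + 1) ∨ ∃ x, (UL.recv, x) ∈ s'.obs ∧ x.addr = j.1 + 1 ∧
        σ j = .mk (x.obs ++ [(UL.send, x)]) (j.1 + 1) := fun j hj hl =>
    (h.latest j hj fun h' => hl (hlef h')).imp_right fun ⟨x, hx, h⟩ => ⟨x, hsub hx, h⟩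
  obtain ⟨σ', hv, hk, hG', hor, hlat⟩ : ∃ σ' : Fin n → UState,
      (ELMOProtocol n w t).ValidState σ' ∧ σ' k = .mk o i ∧
      globalEquivocatorsFull σ' ⊆ localEquivocatorsFull s' ∧
      ((∃ j, (UL.send, m) ∈ (σ' j).obs) ∨ m.addr ∈ localEquivocatorsFull s') ∧
      ∀ j, j ≠ k → j.1 + 1 ∉ localEquivocatorsFull s' →
        σ' j = .mk [] (j.1 + 1) ∨ ∃ x, (UL.recv, x) ∈ s'.obs ∧ x.addr = j.1 + 1 ∧
          σ' j = .mk (x.obs ++ [(UL.send, x)]) (j.1 + 1) := by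
    by_cases hor : (∃ j, (UL.send, m) ∈ (σ j).obs) ∨ m.addr ∈ localEquivocatorsFull s'
    · exact ⟨σ, h.valid, h.eq, hG, hor, hlatest⟩
    push Not at hor
    obtain ⟨hns, hml⟩ := hor
    obtain ⟨j, hj⟩ : ∃ j : Fin n, m.addr = j.1 + 1 := by
      obtain ⟨h1, h2⟩ := hψ.2.1.addr_mem
      exact ⟨⟨m.addr - 1, by omega⟩, by simp; omega⟩
    have hjk : j ≠ k := by
      rintro rfl
      refine hns j ?_
      rw [h.eq]
      exact hψ.2.2.1 (hj.trans hi.symm)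
    have hpre : (σ j).addr = m.addr ∧ (σ j).obs <+: m.obs := by
      rcases h.latest j hjk fun h' => hml (hj ▸ hlef h') with h0 | ⟨x, hx, hxa, h0⟩
      · rw [h0, hj]
        exact ⟨rfl, List.nil_prefix⟩
      · have hxv := hs.msgValidFull_of_mem ⟨_, hx⟩
        have hax : m.addr = x.addr := hj.trans hxa.symm
        have hnsj := hns j
        rw [h0] at hnsj
        simp only [UState.obs, List.mem_append, List.mem_singleton, Prod.mk.injEq, true_and,
          not_or] at hnsj
        have hmx : ¬ mlt m x := fun hlt =>
          hnsj.1 (hxv.send_of_addr (hxv.mem_messages_of_mlt hlt) hax)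
        have hxm : mlt x m := by
          by_contra hxm
          exact hml (mem_localEquivocatorsFull.2
            ⟨m, x, by simp [hs', UState.obs], hsub hx, ⟨hax, hnsj.2, hmx, hxm⟩, rfl⟩)
        rw [h0, hj]
        exact ⟨rfl, hψ.2.1.prefix_of_send (hψ.2.1.send_of_addr
          (hψ.2.1.mem_messages_of_mlt hxm) hax.symm)⟩
    obtain ⟨hv1, hG1⟩ := ELMOProtocol_valid_advance h.valid (k := k) hG hsum
      (by rw [h.eq]; exact hmsg) (hs.of_messages_subset hw ht hψ.2.1 hψ.1) hpre.1.symm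
      (by rw [h.eq]; exact hψ.1) hpre.2
    have hv2 := (ELMOProtocol_valid_send hv1 j (o := m.obs) (i := m.addr)
      (by rw [Function.update_self, UState.mk_obs_addr])).1
    rw [Function.update_idem, UState.mk_obs_addr] at hv2
    refine ⟨_, hv2, ?_, ?_, Or.inl ⟨j, ?_⟩, ?_⟩
    · rw [Function.update_of_ne hjk.symm, h.eq]
    · refine globalEquivocatorsFull_update_subset hG ?_ fun x hx => Or.inl ⟨k, ?_⟩
      · exact List.Subset.trans hpre.2.subset (List.subset_append_left _ _)
      · rw [h.eq]
        exact hψ.1 ⟨UL.recv, by simpa [UState.obs] using hx⟩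
    · rw [Function.update_self]
      exact List.mem_append_right _ (List.mem_singleton.2 rfl)
    · intro j' hj' hl
      by_cases hjj : j' = j
      · subst hjj
        refine Or.inr ⟨m, by simp [hs', UState.obs], hj, ?_⟩
        rw [Function.update_self, hj]
      · rw [Function.update_of_ne hjj]
        exact hlatest j' hj' hl
  have hGs : globalEquivocatorsFull (Function.update σ' k s') ⊆ localEquivocatorsFull s' := by
    refine globalEquivocatorsFull_update_subset hG' (by rw [hk]; exact hsub) fun x hx => ?_
    simp only [hs', UState.obs, List.mem_append, List.mem_singleton, Prod.mk.injEq,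
      true_and] at hx
    rcases hx with hx | rfl
    · exact Or.inl ⟨k, hk ▸ ⟨_, hx⟩⟩
    · exact Or.inr hor
  refine ⟨σ', hv, hk, ELMOProtocol_beta_recv k hk hψ (hsum _ hGs),
    ELMOProtocol_valid_recv hv k hk hm hψ (hsum _ hGs), Function.update_self .., hGs, ?_⟩
  intro j hj hl
  rw [Function.update_of_ne hj]
  exact hlat j hj hl

lemma sizeOf_mk_lt_append (o : List (UL × UState)) (j : ℕ) (x : UL × UState) :
    sizeOf (UState.mk o j) < sizeOf (UState.mk (o ++ [x]) j) := by
  have : sizeOf o < sizeOf (o ++ [x]) := by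
    induction o with
    | nil => simp
    | cons y o ih => simpa using ih
  simpa using this

lemma sizeOf_lt_of_mem_messages {x s : UState} (hx : x ∈ s.messages) :
    sizeOf x < sizeOf s := by
  obtain ⟨o, j⟩ := s
  obtain ⟨l, hl⟩ := hx
  have := List.sizeOf_lt_of_mem (show (l, x) ∈ o from hl)
  simp only [Prod.mk.sizeOf_spec, UState.mk.sizeOf_spec] at this ⊢
  omega

/-- A lift of a reachable state shows that the state is a valid message. -/
lemma ELMOLift.validOMsg {k : Fin n} {s : UState} {σ : Fin n → UState}
    (h : ELMOLift n w t k s σ) : (ELMOProtocol n w t).ValidOMsg (some s) :=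
  s.mk_obs_addr ▸ (ELMOProtocol_valid_send h.valid k (h.eq.trans s.mk_obs_addr.symm)).2

lemma ELMOReach.exists_addr_eq {s : UState} (h : ELMOReach n w t s) :
    ∃ k : Fin n, s.addr = k.1 + 1 := by
  obtain ⟨h1, h2⟩ := h.msgValidFull.addr_mem
  exact ⟨⟨s.addr - 1, by omega⟩, by simp; omega⟩

theorem ELMOReach.exists_lift (hw : ∀ j, 1 ≤ j → j ≤ n → 0 < w j) (ht : 0 < t)
    {s : UState} (hs : ELMOReach n w t s) {k : Fin n} (hk : s.addr = k.1 + 1) :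
    ∃ σ, ELMOLift n w t k s σ := by
  induction hN : sizeOf s using Nat.strong_induction_on generalizing s k with
  | _ N ih =>
    subst hN
    have hvalid : ∀ x, ELMOReach n w t x → sizeOf x < sizeOf s →
        (ELMOProtocol n w t).ValidOMsg (some x) := by
      intro x hx hlt
      obtain ⟨j, hj⟩ := hx.exists_addr_eq
      obtain ⟨σ, hσ⟩ := ih _ hlt hx hj rfl
      exact hσ.validOMsg
    cases hs with
    | nil =>
      obtain rfl : _ = k.1 + 1 := hk
      exact ⟨_, .init k⟩
    | send h =>
      obtain ⟨σ, hσ⟩ := ih _ (sizeOf_mk_lt_append _ _ _) h hk rfl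
      exact ⟨_, hσ.send⟩
    | @recv o j m h hψ =>
      obtain ⟨σ, hσ⟩ := ih _ (sizeOf_mk_lt_append _ _ _) h hk rfl
      obtain ⟨σ', -, -, -, h'⟩ := hσ.exists_recv hw ht hk h hψ
        (hvalid m (h.of_messages_subset hw ht hψ.2.1 hψ.1)
          (sizeOf_lt_of_mem_messages (messages_mk_append.2 (Or.inr rfl))))
        fun x hx => hvalid x (h.of_mem hw ht hx)
          (sizeOf_lt_of_mem_messages (messages_mk_append.2 (Or.inl hx)))
      exact ⟨_, h'⟩

theorem ELMOReach.validOMsg (hw : ∀ j, 1 ≤ j → j ≤ n → 0 < w j) (ht : 0 < t)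
    {s : UState} (hs : ELMOReach n w t s) : (ELMOProtocol n w t).ValidOMsg (some s) := by
  obtain ⟨j, hj⟩ := hs.exists_addr_eq
  obtain ⟨σ, hσ⟩ := hs.exists_lift hw ht hj
  exact hσ.validOMsg

end Lifting

/-- Every ELMO component is a validator for the ELMO protocol. -/
theorem ELMOComponents_validating (n : ℕ) (w : ℕ → ℝ)
    (hw : ∀ j, 1 ≤ j → j ≤ n → 0 < w j) (t : ℝ) (ht : 0 < t) (k : Fin n) :
    IsValidatorAt (fun j : Fin n => ELMO n w t (j.1 + 1)) (ELMOProtocol n w t) k := by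
  intro l s m hs hb
  obtain ⟨hr, haddr⟩ := ELMO_constrainedState_reach (Nat.le_add_left 1 k.1) k.2 hs
  obtain ⟨σ, hσ⟩ := hr.exists_lift hw ht haddr
  suffices h : ∃ σ', (ELMOProtocol n w t).ValidState σ' ∧ σ' k = s ∧
      (ELMOProtocol n w t).ValidOMsg m ∧ (ELMOProtocol n w t).beta ⟨k, l⟩ σ' m by
    obtain ⟨σ', hv, rfl, hm, hbeta⟩ := h
    exact ⟨σ', rfl, ⟨⟨rfl, hbeta⟩, hv, hm⟩, Function.update_self .., rfl⟩
  obtain ⟨⟨rfl, rfl⟩ | ⟨rfl, hne⟩, hψ⟩ := id hb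
  · exact ⟨σ, hσ.valid, hσ.eq, .none, hσ.eq.symm ▸ hb, fun h => by cases h⟩
  · obtain ⟨m, rfl⟩ := Option.ne_none_iff_exists'.1 hne
    have hψ := hψ rfl m rfl
    have hm := (hr.of_messages_subset hw ht hψ.2.1 hψ.1).validOMsg hw ht
    obtain ⟨o, i⟩ := s
    obtain ⟨σ', hv, hk, hbeta, -⟩ := hσ.exists_recv hw ht haddr hr hψ hm
      fun x hx => (hr.of_mem hw ht hx).validOMsg hw ht
    exact ⟨σ', hv, hk, hm, hbeta⟩
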